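/- arXiv:1905.08164 — 5 statements merged into one kernel-verified Lean document; each statement's English description precedes it below -/
import Mathlib

section
/- Let p be a prime, let M1, M2, MT be additive commutative groups that are modules over ZMod p, and let e : M1 →ₗ[ZMod p] M2 →ₗ[ZMod p] MT be a ZMod p-bilinear map. Let g1 ∈ M1, g2 ∈ M2 and sk_iss, sk, r ∈ ZMod p with sk_iss + sk ≠ 0. Define R := (r * (sk_iss + sk)⁻¹) • g1 and B := r • g1 - sk • R. Then e R (sk_iss • g2) = e B g2. (The pairing verification equation e(R, gpk) = e(B, g₂) of the DAA verification procedure holds for honestly generated signatures.) -/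
theorem daa_pairing_check (p : ℕ) [Fact p.Prime]
    (M1 M2 MT : Type*) [AddCommGroup M1] [AddCommGroup M2] [AddCommGroup MT]
    [Module (ZMod p) M1] [Module (ZMod p) M2] [Module (ZMod p) MT]
    (e : M1 →ₗ[ZMod p] M2 →ₗ[ZMod p] MT)
    (g1 : M1) (g2 : M2) (sk_iss sk r : ZMod p) (h : sk_iss + sk ≠ 0)
    (R : M1) (hR : R = (r * (sk_iss + sk)⁻¹) • g1)
    (B : M1) (hB : B = r • g1 - sk • R) :
    e R (sk_iss • g2) = e B g2 := by
  have key : B = sk_iss • R := by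
    have h1 : r • g1 = (sk_iss + sk) • R := by
      rw [hR, smul_smul]
      congr 1
      field_simp
    rw [hB, h1, add_smul, add_sub_cancel_right]
  rw [key, map_smul, map_smul, LinearMap.smul_apply]
end

section
/- Completeness of the DAA signature scheme. Let p be a prime, let M1, M2, MT be additive commutative groups that are modules over ZMod p, and let e : M1 →ₗ[ZMod p] M2 →ₗ[ZMod p] MT be a ZMod p-bilinear map. Let g1 ∈ M1, g2 ∈ M2, D ∈ M1, and sk_iss, sk, r, t1, t2, c ∈ ZMod p with sk_iss + sk ≠ 0. Define A := (sk_iss + sk)⁻¹ • g1, R := r • A, B := r • g1 - sk • R, nym := sk • D, s1 := t1 + c * sk, s2 := t2 + c * r. Then all three verification identities hold: (i) s2 • g1 - s1 • R - c • B = t2 • g1 - t1 • R, (ii) s1 • D - c • nym = t1 • D, and (iii) e R (sk_iss • g2) = e B g2. -/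
theorem daa_completeness (p : ℕ) [Fact p.Prime]
    (M1 M2 MT : Type*) [AddCommGroup M1] [AddCommGroup M2] [AddCommGroup MT]
    [Module (ZMod p) M1] [Module (ZMod p) M2] [Module (ZMod p) MT]
    (e : M1 →ₗ[ZMod p] M2 →ₗ[ZMod p] MT)
    (g1 D : M1) (g2 : M2) (sk_iss sk r t1 t2 c : ZMod p) (h : sk_iss + sk ≠ 0)
    (A : M1) (hA : A = (sk_iss + sk)⁻¹ • g1)
    (R : M1) (hR : R = r • A)
    (B : M1) (hB : B = r • g1 - sk • R)
    (nym : M1) (hnym : nym = sk • D)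
    (s1 s2 : ZMod p) (hs1 : s1 = t1 + c * sk) (hs2 : s2 = t2 + c * r) :
    s2 • g1 - s1 • R - c • B = t2 • g1 - t1 • R ∧
    s1 • D - c • nym = t1 • D ∧
    e R (sk_iss • g2) = e B g2 := by
  have hg : g1 = (sk_iss + sk) • A := by
    rw [hA, smul_smul, mul_inv_cancel₀ h, one_smul]
  have hBR : B = sk_iss • R := by
    rw [hB, hR]
    nth_rewrite 1 [hg]
    module
  refine ⟨?_, ?_, ?_⟩
  · rw [hB, hs1, hs2]
    module
  · rw [hnym, hs1]
    module
  · rw [hBR, map_smul, map_smul, LinearMap.smul_apply]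
end

section
/- Let p be a prime and G an additive commutative group that is a module over ZMod p. Let g, R, B ∈ G and s1, s2, s1', s2', c, c' ∈ ZMod p with c ≠ c'. Suppose s2 • g - s1 • R - c • B = s2' • g - s1' • R - c' • B. Then B = β • g - α • R, where α := (s1 - s1') * (c - c')⁻¹ and β := (s2 - s2') * (c - c')⁻¹. (Knowledge-extraction step of the DAA scheme: two accepting transcripts with the same commitment T̃1 and distinct challenges determine exponents α, β with B = g₁^β · R^{-α}.) -/
theorem daa_extract_B (p : ℕ) [Fact p.Prime]
    (G : Type*) [AddCommGroup G] [Module (ZMod p) G]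
    (g R B : G) (s1 s2 s1' s2' c c' : ZMod p) (hc : c ≠ c')
    (h : s2 • g - s1 • R - c • B = s2' • g - s1' • R - c' • B) :
    B = ((s2 - s2') * (c - c')⁻¹) • g - ((s1 - s1') * (c - c')⁻¹) • R := by
  have hd : c - c' ≠ 0 := sub_ne_zero.mpr hc
  have key : (c - c') • B = (s2 - s2') • g - (s1 - s1') • R := by
    rw [← sub_eq_zero] at h ⊢
    rw [← neg_eq_zero, ← h]
    module
  calc B = (c - c')⁻¹ • ((c - c') • B) := (inv_smul_smul₀ hd B).symm
    _ = _ := by rw [key]; module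
end

section
/- Let p be a prime and G an additive commutative group that is a module over ZMod p. Let D, nym ∈ G and s1, s1', c, c' ∈ ZMod p with c ≠ c'. Suppose s1 • D - c • nym = s1' • D - c' • nym. Then nym = α • D, where α := (s1 - s1') * (c - c')⁻¹. (Knowledge-extraction step of the DAA scheme: two accepting transcripts with the same commitment T̃2 and distinct challenges determine an exponent α with nym = D^α.) -/
theorem daa_extract_nym (p : ℕ) [Fact p.Prime]
    (G : Type*) [AddCommGroup G] [Module (ZMod p) G]
    (D nym : G) (s1 s1' c c' : ZMod p) (hc : c ≠ c')
    (h : s1 • D - c • nym = s1' • D - c' • nym) :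
    nym = ((s1 - s1') * (c - c')⁻¹) • D := by
  have hne : c - c' ≠ 0 := sub_ne_zero.mpr hc
  have key : (s1 - s1') • D = (c - c') • nym := by
    rw [sub_smul, sub_smul, sub_eq_sub_iff_add_eq_add]
    rw [sub_eq_sub_iff_add_eq_add] at h
    rw [h, add_comm]
  rw [mul_comm, mul_smul, key, inv_smul_smul₀ hne]
end

section
/- Existence of a knowledge extractor for the DAA signature of knowledge (algebraic core). Let p be a prime, let M1, M2, MT be additive commutative groups that are modules over ZMod p, and let e : M1 →ₗ[ZMod p] M2 →ₗ[ZMod p] MT be a ZMod p-bilinear map. Let g1, D, R, B, nym ∈ M1, g2 ∈ M2, sk_iss ∈ ZMod p, and let (s1, s2, c) and (s1', s2', c') in (ZMod p)³ with c ≠ c' satisfy: (i) s2 • g1 - s1 • R - c • B = s2' • g1 - s1' • R - c' • B, (ii) s1 • D - c • nym = s1' • D - c' • nym, and (iii) e R (sk_iss • g2) = e B g2. Set α := (s1 - s1') * (c - c')⁻¹ and β := (s2 - s2') * (c - c')⁻¹ and assume β ≠ 0. Then the extracted pair (Â, ŝk) := (β⁻¹ • R, α) satisfies nym = ŝk • D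 and e Â (sk_iss • g2 + ŝk • g2) = e g1 g2. -/
theorem daa_knowledge_extractor (p : ℕ) [Fact p.Prime]
    (M1 M2 MT : Type*) [AddCommGroup M1] [AddCommGroup M2] [AddCommGroup MT]
    [Module (ZMod p) M1] [Module (ZMod p) M2] [Module (ZMod p) MT]
    (e : M1 →ₗ[ZMod p] M2 →ₗ[ZMod p] MT)
    (g1 D R B nym : M1) (g2 : M2) (sk_iss : ZMod p)
    (s1 s2 c s1' s2' c' : ZMod p) (hc : c ≠ c')
    (h1 : s2 • g1 - s1 • R - c • B = s2' • g1 - s1' • R - c' • B)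
    (h2 : s1 • D - c • nym = s1' • D - c' • nym)
    (h3 : e R (sk_iss • g2) = e B g2)
    (α β : ZMod p)
    (hα : α = (s1 - s1') * (c - c')⁻¹) (hβ : β = (s2 - s2') * (c - c')⁻¹)
    (hβ0 : β ≠ 0) :
    nym = α • D ∧ e (β⁻¹ • R) (sk_iss • g2 + α • g2) = e g1 g2 := by
  have hd : c - c' ≠ 0 := sub_ne_zero.mpr hc
  have ha : s1 - s1' = (c - c') * α := by rw [hα]; field_simp
  have hb : s2 - s2' = (c - c') * β := by rw [hβ]; field_simp
  have k2 : (c - c') • nym = (c - c') • (α • D) := by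
    rw [smul_smul, ← ha, sub_smul, sub_smul]
    have := sub_eq_zero.mpr h2
    rw [← sub_eq_zero, ← neg_eq_zero, ← this]
    abel
  have k1 : (c - c') • (β • g1) = (c - c') • (α • R + B) := by
    rw [smul_add, smul_smul, smul_smul, ← ha, ← hb, sub_smul, sub_smul, sub_smul]
    have := sub_eq_zero.mpr h1
    rw [← sub_eq_zero, ← this]
    abel
  have k1' := smul_right_injective M1 hd k1
  refine ⟨smul_right_injective M1 hd k2, ?_⟩
  have key : e R (sk_iss • g2 + α • g2) = β • e g1 g2 := by
    have h := congrArg (fun x => e x g2) k1'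
    simp only [map_add, map_smul, LinearMap.add_apply, LinearMap.smul_apply] at h
    rw [map_add, h3, h, map_smul, add_comm]
  rw [map_smul, LinearMap.smul_apply, key, smul_smul, inv_mul_cancel₀ hβ0, one_smul]
end
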